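/- arXiv:2003.12985 — 2 statements merged into one kernel-verified Lean document; each statement's English description precedes it below -/
import Mathlib

section
/- For every K ≥ 1, let Y ∈ ℝ^{(K+1)×(K+1)} be the matrix with 0 on the diagonal and 1 in every off-diagonal entry (Y = J − I). Then: (i) every column of Y has exactly K nonzero entries, so Y ∈ S_K^SP (witnessed by D = I); (ii) Y is invertible, i.e., rank(Y) = K+1 > K, so Y ∉ S_K^LR; and (iii) there exist no orthogonal D ∈ ℝ^{(K+1)×(K+1)} and matrix X with at most K nonzero rows such that Y = D X, so Y ∉ S_K^JS. Consequently, S_K^JS ⊊ S_K^SP and S_K^SP ⊄ S_K^LR. -/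
open Matrix Finset

/-- `D` is orthogonal (unitary real dictionary): `Dᵀ D = I`. -/
def IsOrthogonal {n : ℕ} (D : Matrix (Fin n) (Fin n) ℝ) : Prop := Dᵀ * D = 1

/-- A vector is `K`-sparse if it has at most `K` nonzero entries. -/
def KSparseVec {n : ℕ} (K : ℕ) (x : Fin n → ℝ) : Prop :=
  (Finset.univ.filter (fun i => x i ≠ 0)).card ≤ K

/-- A matrix is column-wise `K`-sparse if every column has at most `K` nonzero entries. -/
def ColKSparse {n M : ℕ} (K : ℕ) (X : Matrix (Fin n) (Fin M) ℝ) : Prop :=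
  ∀ j : Fin M, KSparseVec K (fun i => X i j)

/-- A matrix is jointly `K`-sparse if it has at most `K` nonzero rows. -/
def JointKSparse {n M : ℕ} (K : ℕ) (X : Matrix (Fin n) (Fin M) ℝ) : Prop :=
  (Finset.univ.filter (fun i => (fun j => X i j) ≠ 0)).card ≤ K

/-- the matrix `Y = J − I ∈ ℝ^{(K+1)×(K+1)}` (zero diagonal, ones elsewhere)
is in `S_K^SP` (each column has exactly `K` nonzeros, witnessed by `D = I`), has full rank
`K+1` so `Y ∉ S_K^LR`, and admits no jointly `K`-sparse unitary factorization, so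
`Y ∉ S_K^JS`. Consequently `S_K^JS ⊊ S_K^SP` and `S_K^SP ⊄ S_K^LR`. -/
theorem JminusI_SP_not_LR_not_JS (K : ℕ) (hK : 1 ≤ K) :
    let Y : Matrix (Fin (K + 1)) (Fin (K + 1)) ℝ := fun i j => if i = j then 0 else 1
    (∀ j, (Finset.univ.filter (fun i => Y i j ≠ 0)).card = K) ∧
    (∃ (D : Matrix (Fin (K + 1)) (Fin (K + 1)) ℝ) (X : Matrix (Fin (K + 1)) (Fin (K + 1)) ℝ),
      IsOrthogonal D ∧ ColKSparse K X ∧ Y = D * X) ∧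
    Y.rank = K + 1 ∧ ¬ (Y.rank ≤ K) ∧
    ¬ (∃ (D : Matrix (Fin (K + 1)) (Fin (K + 1)) ℝ) (X : Matrix (Fin (K + 1)) (Fin (K + 1)) ℝ),
      IsOrthogonal D ∧ JointKSparse K X ∧ Y = D * X) := by
  intro Y
  have hK0 : (K : ℝ) ≠ 0 := by
    have : K ≠ 0 := by omega
    exact_mod_cast this
  have hcol : ∀ j, (Finset.univ.filter (fun i => Y i j ≠ 0)).card = K := by
    intro j
    have h : Finset.univ.filter (fun i => Y i j ≠ 0) = Finset.univ.erase j := by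
      ext i
      simp [Y]
    rw [h, Finset.card_erase_of_mem (Finset.mem_univ j)]
    simp
  -- the explicit inverse of `J - I` is `J / K - I`
  let Z : Matrix (Fin (K + 1)) (Fin (K + 1)) ℝ :=
    fun i j => 1 / (K : ℝ) - if i = j then 1 else 0
  have hYZ : Y * Z = 1 := by
    ext i j
    have h : ∀ k, Y i k * Z k j = 1 / (K : ℝ) - (if k = j then 1 else 0)
        - (if i = k then 1 / (K : ℝ) - (if i = j then 1 else 0) else 0) := by
      intro k
      by_cases hik : i = k
      · subst hik
        simp [Y, Z]
      · simp [Y, Z, hik]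
    rw [Matrix.mul_apply, Finset.sum_congr rfl (fun k _ => h k)]
    simp only [Finset.sum_sub_distrib, Finset.sum_ite_eq, Finset.sum_ite_eq', Finset.sum_const,
      Finset.mem_univ, if_true, Finset.card_univ, Fintype.card_fin, nsmul_eq_mul,
      Matrix.one_apply]
    push_cast
    field_simp
    ring
  have hrank : Y.rank = K + 1 := by
    have hu : IsUnit Y := IsUnit.of_mul_eq_one Z hYZ
    simpa using Matrix.rank_of_isUnit Y hu
  refine ⟨hcol, ⟨1, Y, ?_, fun j => (hcol j).le, (one_mul Y).symm⟩, hrank, by omega, ?_⟩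
  · simp [IsOrthogonal]
  · rintro ⟨D, X, -, hX, hY⟩
    have hrow : ∃ i, (fun j => X i j) = 0 := by
      by_contra! hne
      have h : Finset.univ.filter (fun i => (fun j => X i j) ≠ 0) = Finset.univ :=
        Finset.filter_true_of_mem (fun i _ => hne i)
      unfold JointKSparse at hX
      rw [h] at hX
      simp at hX
    obtain ⟨i, hi⟩ := hrow
    have h1 : D * (X * Z) = 1 := by rw [← Matrix.mul_assoc, ← hY, hYZ]
    have h2 : X * (Z * D) = 1 := by
      rw [← Matrix.mul_assoc]
      exact mul_eq_one_comm.mp h1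
    have h3 := congrFun (congrFun h2 i) i
    have h4 : ∀ j, X i j = 0 := fun j => congrFun hi j
    simp [Matrix.mul_apply, h4] at h3
end

section
/- Let 1 ≤ K < n and let v₁,…,v_m ∈ ℝⁿ be vectors such that every subset of K+1 of them is linearly independent. If m > C(n,K)·K (where C(n,K) is the binomial coefficient), then for every invertible matrix D ∈ ℝ^{n×n} there exists an index j such that D⁻¹ v_j has more than K nonzero entries; i.e., no single dictionary with n atoms can K-sparsify all of the vectors. -/
open Matrix Finset

/-- pigeonhole core of Lemma 7: if more than `C(n,K)·K` vectors in ℝⁿ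
are in general position w.r.t. `K`, then no invertible dictionary `D` can `K`-sparsify
all of them: some `D⁻¹ v_j` has more than `K` nonzero entries. -/
theorem no_dictionary_sparsifies_general_position {n m K : ℕ}
    (hK1 : 1 ≤ K) (hKn : K < n)
    (v : Fin m → (Fin n → ℝ))
    (hgen : ∀ s : Finset (Fin m), s.card = K + 1 →
      LinearIndependent ℝ (fun i : s => v i))
    (hm : Nat.choose n K * K < m)
    (D : Matrix (Fin n) (Fin n) ℝ) (hD : IsUnit D) :
    ∃ j : Fin m, K < (Finset.univ.filter (fun i => D⁻¹.mulVec (v j) i ≠ 0)).card := by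
  classical
  by_contra! hcon
  have hT : ∀ j : Fin m, ∃ T : Finset (Fin n),
      (Finset.univ.filter (fun i => D⁻¹.mulVec (v j) i ≠ 0)) ⊆ T ∧ T.card = K := by
    intro j
    exact Finset.exists_superset_card_eq (hcon j) (by simpa using hKn.le)
  choose T hsub hcard using hT
  obtain ⟨U, hU, hfib⟩ := Finset.exists_lt_card_fiber_of_mul_lt_card_of_maps_to
    (s := (Finset.univ : Finset (Fin m))) (t := Finset.powersetCard K (Finset.univ : Finset (Fin n)))
    (f := T) (n := K) (fun j _ => by simp [Finset.mem_powersetCard, hcard j])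
    (by simpa using hm)
  obtain ⟨s, hs, hsc⟩ := Finset.exists_subset_card_eq (Nat.succ_le_of_lt hfib)
  have hli := hgen s hsc
  have hUc : U.card = K := (Finset.mem_powersetCard.1 hU).2
  have hzero : ∀ i : s, ∀ t, t ∉ U → D⁻¹.mulVec (v i) t = 0 := by
    intro i t ht
    by_contra hne
    have h1 : T i = U := (Finset.mem_filter.1 (hs i.2)).2
    exact ht (h1 ▸ hsub i (by simpa using hne))
  have hli2 : LinearIndependent ℝ (fun i : s => (fun t : U => D⁻¹.mulVec (v i) t)) := by
    rw [Fintype.linearIndependent_iff] at hli ⊢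
    intro c hc
    apply hli c
    have h0 : D⁻¹.mulVec (∑ i, c i • v i) = 0 := by
      have : D⁻¹.mulVec (∑ i, c i • v i) = ∑ i, c i • D⁻¹.mulVec (v i) := by
        have := map_sum D⁻¹.mulVecLin (fun i : s => c i • v i) Finset.univ
        simpa only [map_smul, Matrix.mulVecLin_apply] using this
      rw [this]
      funext t
      by_cases ht : t ∈ U
      · have := congrFun hc ⟨t, ht⟩
        simpa [Finset.sum_apply] using this
      · simp only [Finset.sum_apply, Pi.smul_apply, Pi.zero_apply]
        exact Finset.sum_eq_zero fun i _ => by rw [hzero i t ht, smul_zero]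
    have h2 := congrArg D.mulVec h0
    rwa [Matrix.mulVec_mulVec, Matrix.mul_nonsing_inv D ((Matrix.isUnit_iff_isUnit_det D).1 hD),
      Matrix.one_mulVec, Matrix.mulVec_zero] at h2
  have := hli2.fintype_card_le_finrank
  simp only [Fintype.card_coe, Module.finrank_fintype_fun_eq_card] at this
  omega
end
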